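/- Let U be an unbounded strictly convex plane domain with smooth boundary. Then U is uniquely determined in the class of all plane domains with smooth boundaries by the condition of local isometry of boundaries in the relative metrics: for every plane domain V with smooth boundary, if there exists a bijective local isometry f: ∂U → ∂V in the relative metrics, then there exists a Euclidean isometry J: ℝ² → ℝ² with J(U) = V. -/

import Mathlib

open Set Filter Metric Topology ENNReal

noncomputable section

/-- A domain in `ℝⁿ`: a nonempty open connected set. -/
def IsDomainSet {n : ℕ} (U : Set (EuclideanSpace ℝ (Fin n))) : Prop :=
  IsOpen U ∧ IsConnected U

/-- The infimum of lengths of smooth paths joining `a` and `b` inside `U`. -/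
def smoothPathInf {n : ℕ} (U : Set (EuclideanSpace ℝ (Fin n)))
    (a b : EuclideanSpace ℝ (Fin n)) : ℝ≥0∞ :=
  ⨅ (γ : ℝ → EuclideanSpace ℝ (Fin n)) (_ : ContDiff ℝ 1 γ) (_ : γ 0 = a)
    (_ : γ 1 = b) (_ : ∀ t ∈ Icc (0:ℝ) 1, γ t ∈ U), eVariationOn γ (Icc 0 1)

/-- The relative metric `ρ_{∂U,U}`:
`ρ(x,y) = liminf_{x'→x, y'→y; x',y'∈U} inf{length γ : γ smooth path joining x',y' in U}`. -/
def relDist {n : ℕ} (U : Set (EuclideanSpace ℝ (Fin n)))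
    (x y : EuclideanSpace ℝ (Fin n)) : ℝ≥0∞ :=
  Filter.liminf (fun p : EuclideanSpace ℝ (Fin n) × EuclideanSpace ℝ (Fin n) =>
    smoothPathInf U p.1 p.2) ((𝓝[U] x) ×ˢ (𝓝[U] y))

/-- `f` is a bijection of `∂U` onto `∂V` which is a local isometry
in the relative metrics of the boundaries. -/
def IsBoundaryLocalIsometry {n : ℕ} (U V : Set (EuclideanSpace ℝ (Fin n)))
    (f : EuclideanSpace ℝ (Fin n) → EuclideanSpace ℝ (Fin n)) : Prop :=
  Set.BijOn f (frontier U) (frontier V) ∧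
  ∀ y ∈ frontier U, ∃ ε : ℝ≥0∞, 0 < ε ∧ ∀ a ∈ frontier U, ∀ b ∈ frontier U,
    relDist U a y < ε → relDist U b y < ε →
      relDist U a b = relDist V (f a) (f b)

/-- `U` has smooth boundary: `∂U` is an `(n-1)`-dimensional submanifold of
class `C¹` without boundary, i.e. near each of its points the frontier can be
mapped by a `C¹` diffeomorphism onto an open piece of a hyperplane. -/
def HasC1Boundary {n : ℕ} (U : Set (EuclideanSpace ℝ (Fin n))) : Prop :=
  ∀ x ∈ frontier U, ∃ (W W' : Set (EuclideanSpace ℝ (Fin n)))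
    (φ ψ : EuclideanSpace ℝ (Fin n) → EuclideanSpace ℝ (Fin n))
    (ℓ : EuclideanSpace ℝ (Fin n) →L[ℝ] ℝ),
    IsOpen W ∧ x ∈ W ∧ IsOpen W' ∧ ℓ ≠ 0 ∧
    ContDiffOn ℝ 1 φ W ∧ ContDiffOn ℝ 1 ψ W' ∧
    Set.MapsTo φ W W' ∧ Set.MapsTo ψ W' W ∧
    (∀ z ∈ W, ψ (φ z) = z) ∧ (∀ z ∈ W', φ (ψ z) = z) ∧
    φ '' (W ∩ frontier U) = W' ∩ {y | ℓ y = 0}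

/-- The intrinsic distance inside a set `S`: the infimum of lengths of
(continuous) paths joining `a` and `b` inside `S`. -/
def intrinsicDist {n : ℕ} (S : Set (EuclideanSpace ℝ (Fin n)))
    (a b : EuclideanSpace ℝ (Fin n)) : ℝ≥0∞ :=
  ⨅ (γ : ℝ → EuclideanSpace ℝ (Fin n)) (_ : ContinuousOn γ (Icc (0:ℝ) 1))
    (_ : γ 0 = a) (_ : γ 1 = b) (_ : ∀ t ∈ Icc (0:ℝ) 1, γ t ∈ S),
    eVariationOn γ (Icc 0 1)

/-- A strictly convex domain: convex, and the open segment joining any two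
distinct points of its closure is contained in the domain. -/
def IsStrictlyConvexDomain {n : ℕ} (U : Set (EuclideanSpace ℝ (Fin n))) : Prop :=
  Convex ℝ U ∧ ∀ a ∈ closure U, ∀ b ∈ closure U, a ≠ b → openSegment ℝ a b ⊆ U

section RelativeMetric

variable {n : ℕ} {U : Set (EuclideanSpace ℝ (Fin n))}

local notation "𝔼" => EuclideanSpace ℝ (Fin n)

theorem smoothPathInf_le {γ : ℝ → 𝔼} (hγ : ContDiff ℝ 1 γ)
    (hU : ∀ t ∈ Icc (0 : ℝ) 1, γ t ∈ U) :
    smoothPathInf U (γ 0) (γ 1) ≤ eVariationOn γ (Icc 0 1) :=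
  iInf_le_of_le γ <| iInf_le_of_le hγ <| iInf_le_of_le rfl <| iInf_le_of_le rfl <|
    iInf_le_of_le hU le_rfl

theorem exists_path_of_smoothPathInf_lt {a b : 𝔼} {c : ℝ≥0∞} (h : smoothPathInf U a b < c) :
    ∃ γ : ℝ → 𝔼, ContDiff ℝ 1 γ ∧ γ 0 = a ∧ γ 1 = b ∧ (∀ t ∈ Icc (0 : ℝ) 1, γ t ∈ U) ∧
      eVariationOn γ (Icc 0 1) < c := by
  simp only [smoothPathInf, iInf_lt_iff] at h
  obtain ⟨γ, h1, h2, h3, h4, h5⟩ := h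
  exact ⟨γ, h1, h2, h3, h4, h5⟩

theorem edist_le_smoothPathInf (U : Set 𝔼) (a b : 𝔼) : edist a b ≤ smoothPathInf U a b := by
  simp only [smoothPathInf, le_iInf_iff]
  rintro γ - rfl rfl -
  exact eVariationOn.edist_le γ (by simp) (by simp)

theorem smoothPathInf_le_subpath {γ : ℝ → 𝔼} (hγ : ContDiff ℝ 1 γ) {s t : ℝ} (hst : s ≤ t)
    (hU : ∀ r ∈ Icc s t, γ r ∈ U) :
    smoothPathInf U (γ s) (γ t) ≤ eVariationOn γ (Icc s t) := by
  have hmaps : MapsTo (fun r : ℝ => s + r * (t - s)) (Icc 0 1) (Icc s t) := by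
    rintro r ⟨h0, h1⟩
    constructor <;> nlinarith
  have hmono : MonotoneOn (fun r : ℝ => s + r * (t - s)) (Icc 0 1) := by
    intro r _ r' _ h
    dsimp only
    gcongr
  have h := smoothPathInf_le (U := U) (γ := γ ∘ fun r : ℝ => s + r * (t - s))
    (hγ.comp (by fun_prop)) (fun r hr => hU _ (hmaps hr))
  simp only [Function.comp_apply, zero_mul, add_zero, one_mul, add_sub_cancel] at h
  exact h.trans (eVariationOn.comp_le_of_monotoneOn γ _ hmono hmaps)

theorem smoothPathInf_le_edist {a b : 𝔼} (h : segment ℝ a b ⊆ U) :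
    smoothPathInf U a b ≤ edist a b := by
  have hl : LipschitzWith (nndist a b) (AffineMap.lineMap a b : ℝ → 𝔼) := lipschitzWith_lineMap a b
  have := smoothPathInf_le (U := U) (γ := fun t : ℝ => AffineMap.lineMap a b t)
    (by simp only [AffineMap.lineMap_apply_module']; fun_prop)
    (fun t ht => h (by rw [segment_eq_image_lineMap]; exact mem_image_of_mem _ ht))
  simp only [AffineMap.lineMap_apply_zero, AffineMap.lineMap_apply_one] at this
  refine this.trans ?_
  have h2 := (hl.lipschitzOnWith (s := univ)).comp_eVariationOn_le (g := id)
    (mapsTo_univ _ (Icc (0 : ℝ) 1))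
  rw [eVariationOn_id_Icc] at h2
  rwa [Function.comp_id, sub_zero, ENNReal.ofReal_one, mul_one, ← edist_nndist] at h2

theorem smoothPathInf_triangle (U : Set 𝔼) (a b c : 𝔼) :
    smoothPathInf U a c ≤ smoothPathInf U a b + smoothPathInf U b c := by
  refine le_of_forall_gt fun r hr => ?_
  obtain ⟨r₁, h₁, r₂, h₂, hr'⟩ := ENNReal.exists_add_lt_of_add_lt hr
  obtain ⟨γ₁, g1, rfl, rfl, hU1, hv1⟩ := exists_path_of_smoothPathInf_lt h₁
  obtain ⟨γ₂, g2, g20, rfl, hU2, hv2⟩ := exists_path_of_smoothPathInf_lt h₂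
  set S := Real.smoothTransition
  have hS : ContDiff ℝ 1 S := Real.smoothTransition.contDiff (n := 1)
  have hSI : ∀ t, S t ∈ Icc (0 : ℝ) 1 := fun t =>
    ⟨Real.smoothTransition.nonneg t, Real.smoothTransition.le_one t⟩
  set γ : ℝ → 𝔼 := fun t => γ₁ (S (2 * t)) + γ₂ (S (2 * t - 1)) - γ₁ 1 with hγ
  have hc : ContDiff ℝ 1 γ := by
    refine ContDiff.sub (ContDiff.add (g1.comp (hS.comp (by fun_prop)))
      (g2.comp (hS.comp (by fun_prop)))) contDiff_const
  have hleft : ∀ t ≤ (1 / 2 : ℝ), γ t = γ₁ (S (2 * t)) := fun t ht => by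
    simp only [hγ]
    rw [show S (2 * t - 1) = 0 from Real.smoothTransition.zero_of_nonpos (by linarith), g20]
    simp
  have hright : ∀ t ≥ (1 / 2 : ℝ), γ t = γ₂ (S (2 * t - 1)) := fun t ht => by
    simp only [hγ]
    rw [show S (2 * t) = 1 from Real.smoothTransition.one_of_one_le (by linarith)]
    simp
  have h0 : γ 0 = γ₁ 0 := by
    rw [hleft 0 (by norm_num), mul_zero]
    exact congrArg γ₁ Real.smoothTransition.zero
  have h1 : γ 1 = γ₂ 1 := by
    rw [hright 1 (by norm_num), show (2 * 1 - 1 : ℝ) = 1 by norm_num]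
    exact congrArg γ₂ Real.smoothTransition.one
  have hγU : ∀ t ∈ Icc (0 : ℝ) 1, γ t ∈ U := fun t _ => by
    rcases le_total t (1 / 2) with h | h
    · rw [hleft t h]; exact hU1 _ (hSI _)
    · rw [hright t h]; exact hU2 _ (hSI _)
  have key := smoothPathInf_le hc hγU
  rw [h0, h1] at key
  have hsplit : eVariationOn γ (Icc 0 1) =
      eVariationOn γ (Icc 0 (1 / 2)) + eVariationOn γ (Icc (1 / 2) 1) := by
    have := eVariationOn.Icc_add_Icc γ (s := univ) (a := 0) (b := 1 / 2) (c := (1 : ℝ))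
      (by norm_num) (by norm_num) (mem_univ _)
    simpa only [univ_inter] using this.symm
  have e1 : eVariationOn γ (Icc 0 (1 / 2)) ≤ eVariationOn γ₁ (Icc 0 1) := by
    rw [eVariationOn.congr (g := γ₁ ∘ fun t => S (2 * t)) fun t ht => hleft t ht.2]
    refine eVariationOn.comp_le_of_monotoneOn γ₁ _ (fun t _ t' _ h => ?_) fun t _ => hSI _
    exact Real.smoothTransition.monotone (by linarith)
  have e2 : eVariationOn γ (Icc (1 / 2) 1) ≤ eVariationOn γ₂ (Icc 0 1) := by
    rw [eVariationOn.congr (g := γ₂ ∘ fun t => S (2 * t - 1)) fun t ht => hright t ht.1]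
    refine eVariationOn.comp_le_of_monotoneOn γ₂ _ (fun t _ t' _ h => ?_) fun t _ => hSI _
    exact Real.smoothTransition.monotone (by linarith)
  calc _ ≤ _ := key
    _ ≤ eVariationOn γ₁ (Icc 0 1) + eVariationOn γ₂ (Icc 0 1) := hsplit.le.trans (add_le_add e1 e2)
    _ < r₁ + r₂ := ENNReal.add_lt_add hv1 hv2
    _ < r := hr'

/-- A path of length less than `L` can be reparametrized so that the inner distance between
points is controlled by `L` times the difference of parameters. -/
theorem exists_lipschitz_param {a b : 𝔼} {L : ℝ}
    (h : smoothPathInf U a b < ENNReal.ofReal L) :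
    ∃ x : ℝ → 𝔼, x 0 = a ∧ x 1 = b ∧ (∀ s ∈ Icc (0 : ℝ) 1, x s ∈ U) ∧
      ∀ s t, 0 ≤ s → s ≤ t → t ≤ 1 →
        smoothPathInf U (x s) (x t) ≤ ENNReal.ofReal (L * (t - s)) := by
  have hL : 0 < L := ENNReal.ofReal_pos.1 (h.trans_le' zero_le)
  obtain ⟨γ, hγ, rfl, rfl, hU, hv⟩ := exists_path_of_smoothPathInf_lt h
  have hbv : BoundedVariationOn γ (Icc 0 1) := hv.ne_top
  obtain ⟨K, hK⟩ : ∃ K, LipschitzOnWith K γ (Icc 0 1) :=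
    hγ.contDiffOn.exists_lipschitzOnWith (by norm_num) (convex_Icc _ _) isCompact_Icc
  set φ : ℝ → ℝ := fun t => (eVariationOn γ (Icc 0 t)).toReal +
    (L - (eVariationOn γ (Icc 0 1)).toReal) * t with hφ
  have hfin : ∀ s t, 0 ≤ s → t ≤ 1 → eVariationOn γ (Icc s t) ≠ ⊤ := fun s t hs ht =>
    hbv.mono (Icc_subset_Icc hs ht)
  have hpos : 0 < L - (eVariationOn γ (Icc 0 1)).toReal :=
    sub_pos.2 ((ENNReal.lt_ofReal_iff_toReal_lt hbv).1 hv)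
  have hadd : ∀ s t, 0 ≤ s → s ≤ t → t ≤ 1 →
      φ t - φ s = (eVariationOn γ (Icc s t)).toReal +
        (L - (eVariationOn γ (Icc 0 1)).toReal) * (t - s) := fun s t h0 hst h1 => by
    have := eVariationOn.Icc_add_Icc γ (s := univ) h0 hst (mem_univ _)
    simp only [univ_inter] at this
    simp only [hφ]
    rw [← this, ENNReal.toReal_add (hfin _ _ le_rfl (hst.trans h1)) (hfin _ _ h0 h1)]
    ring
  have hmono : ∀ s t, 0 ≤ s → s < t → t ≤ 1 → φ s < φ t := fun s t h0 hst h1 => by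
    have := hadd s t h0 hst.le h1
    have h3 : 0 < (L - (eVariationOn γ (Icc 0 1)).toReal) * (t - s) :=
      mul_pos hpos (by linarith)
    have : 0 ≤ (eVariationOn γ (Icc s t)).toReal := ENNReal.toReal_nonneg
    linarith
  have hlip : ∀ s t, 0 ≤ s → s ≤ t → t ≤ 1 → (eVariationOn γ (Icc s t)).toReal ≤ K * (t - s) := by
    intro s t h0 hst h1
    have h2 := (hK.mono (Icc_subset_Icc h0 h1)).comp_eVariationOn_le (g := id) (mapsTo_id (Icc s t))
    rw [eVariationOn_id_Icc, Function.comp_id] at h2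
    refine (ENNReal.toReal_mono (by finiteness) h2).trans ?_
    simp [hst]
  have hcont : ContinuousOn φ (Icc 0 1) := by
    have : LipschitzOnWith (K + Real.toNNReal (L - (eVariationOn γ (Icc 0 1)).toReal)) φ (Icc 0 1) := by
      refine LipschitzOnWith.of_le_add_mul _ fun s hs t ht => ?_
      rcases le_total s t with hst | hst
      · rcases hst.eq_or_lt with rfl | hlt
        · simp
        · exact (hmono s t hs.1 hlt ht.2).le.trans (le_add_of_nonneg_right (by positivity))
      · have e := hadd t s ht.1 hst hs.2
        have := hlip t s ht.1 hst hs.2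
        rw [Real.dist_eq, abs_of_nonneg (by linarith)]
        rw [NNReal.coe_add, Real.coe_toNNReal _ hpos.le]
        linarith
    exact this.continuousOn
  have hφ0 : φ 0 = 0 := by simp [hφ]
  have hφ1 : φ 1 = L := by simp [hφ]
  have hsurj : ∀ s ∈ Icc (0 : ℝ) 1, ∃ t ∈ Icc (0 : ℝ) 1, φ t = L * s := by
    intro s hs
    have := intermediate_value_Icc (zero_le_one (α := ℝ)) hcont
    rw [hφ0, hφ1] at this
    exact this ⟨by have := hs.1; positivity, mul_le_of_le_one_right hL.le hs.2⟩
  choose! σ hσ hσφ using hsurj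
  have hinj : ∀ s ∈ Icc (0 : ℝ) 1, ∀ t ∈ Icc (0 : ℝ) 1, φ s ≤ φ t → s ≤ t :=
    fun s hs t ht hle => not_lt.1 fun hlt => (hmono t s ht.1 hlt hs.2).not_ge hle
  have m0 : (0 : ℝ) ∈ Icc (0 : ℝ) 1 := by simp
  have m1 : (1 : ℝ) ∈ Icc (0 : ℝ) 1 := by simp
  have hσ0 : σ 0 = 0 := le_antisymm
    (hinj _ (hσ _ m0) _ m0 (by rw [hσφ _ m0, hφ0, mul_zero])) (hσ _ m0).1
  have hσ1 : σ 1 = 1 := le_antisymm (hσ _ m1).2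
    (hinj _ m1 _ (hσ _ m1) (by rw [hσφ _ m1, hφ1, mul_one]))
  refine ⟨γ ∘ σ, by simp [hσ0], by simp [hσ1], fun s hs => hU _ (hσ s hs), fun s t h0 hst h1 => ?_⟩
  have ms : s ∈ Icc (0 : ℝ) 1 := ⟨h0, hst.trans h1⟩
  have mt : t ∈ Icc (0 : ℝ) 1 := ⟨h0.trans hst, h1⟩
  have hle : σ s ≤ σ t := hinj _ (hσ _ ms) _ (hσ _ mt) (by
    rw [hσφ _ ms, hσφ _ mt]; gcongr)
  refine (smoothPathInf_le_subpath hγ hle fun r hr =>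
    hU r ⟨(hσ _ ms).1.trans hr.1, hr.2.trans (hσ _ mt).2⟩).trans ?_
  refine (ENNReal.le_ofReal_iff_toReal_le (hfin _ _ (hσ _ ms).1 (hσ _ mt).2)
    (mul_nonneg hL.le (by linarith))).2 ?_
  have e := hadd _ _ (hσ _ ms).1 hle (hσ _ mt).2
  rw [hσφ _ ms, hσφ _ mt] at e
  have : 0 ≤ (L - (eVariationOn γ (Icc 0 1)).toReal) * (σ t - σ s) :=
    mul_nonneg hpos.le (by linarith)
  linarith

theorem edist_le_relDist {x y : 𝔼} : edist x y ≤ relDist U x y := by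
  have ht : Tendsto (fun p : 𝔼 × 𝔼 => edist p.1 p.2) (𝓝[U] x ×ˢ 𝓝[U] y) (𝓝 (edist x y)) := by
    have : Tendsto (fun p : 𝔼 × 𝔼 => edist p.1 p.2) (𝓝 x ×ˢ 𝓝 y) (𝓝 (edist x y)) := by
      rw [← nhds_prod_eq]
      exact (continuous_edist (α := 𝔼)).tendsto (x, y)
    exact this.mono_left (Filter.prod_mono nhdsWithin_le_nhds nhdsWithin_le_nhds)
  rcases (𝓝[U] x ×ˢ 𝓝[U] y).eq_or_neBot with h | h
  · simp [relDist, h]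
  · rw [← ht.liminf_eq]
    exact liminf_le_liminf (Eventually.of_forall fun p => edist_le_smoothPathInf U p.1 p.2)

theorem relDist_le_of_tendsto {ι : Type*} {l : Filter ι} [l.NeBot] {u v : ι → 𝔼} {x y : 𝔼}
    {c : ι → ℝ≥0∞} {c₀ : ℝ≥0∞} (hu : Tendsto u l (𝓝 x)) (hv : Tendsto v l (𝓝 y))
    (huU : ∀ᶠ i in l, u i ∈ U) (hvU : ∀ᶠ i in l, v i ∈ U)
    (hle : ∀ᶠ i in l, smoothPathInf U (u i) (v i) ≤ c i) (hc : Tendsto c l (𝓝 c₀)) :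
    relDist U x y ≤ c₀ := by
  have h1 : Tendsto (fun i => (u i, v i)) l (𝓝[U] x ×ˢ 𝓝[U] y) :=
    (tendsto_nhdsWithin_iff.2 ⟨hu, huU⟩).prodMk (tendsto_nhdsWithin_iff.2 ⟨hv, hvU⟩)
  rw [← hc.liminf_eq]
  calc relDist U x y ≤ liminf (fun p : 𝔼 × 𝔼 => smoothPathInf U p.1 p.2)
        (map (fun i => (u i, v i)) l) := liminf_le_liminf_of_le h1
    _ ≤ liminf c l := liminf_le_liminf hle

theorem relDist_eq_edist_of_convex (hU : Convex ℝ U) {x y : 𝔼} (hx : x ∈ closure U)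
    (hy : y ∈ closure U) : relDist U x y = edist x y := by
  refine le_antisymm ?_ edist_le_relDist
  have := mem_closure_iff_nhdsWithin_neBot.1 hx
  have := mem_closure_iff_nhdsWithin_neBot.1 hy
  have h1 : Tendsto Prod.fst (𝓝[U] x ×ˢ 𝓝[U] y) (𝓝[U] x) := tendsto_fst
  have h2 : Tendsto Prod.snd (𝓝[U] x ×ˢ 𝓝[U] y) (𝓝[U] y) := tendsto_snd
  rw [tendsto_nhdsWithin_iff] at h1 h2
  refine relDist_le_of_tendsto (l := 𝓝[U] x ×ˢ 𝓝[U] y) h1.1 h2.1 h1.2 h2.2 ?_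
    (Filter.Tendsto.edist h1.1 h2.1)
  filter_upwards [h1.2, h2.2] with p hp hq
  exact smoothPathInf_le_edist (hU.segment_subset hp hq)

end RelativeMetric

section Geodesics

variable {n : ℕ} {V : Set (EuclideanSpace ℝ (Fin n))}

local notation "𝔼" => EuclideanSpace ℝ (Fin n)

theorem dist_eq_of_locally_dist_eq {x : ℝ → 𝔼} {d s₀ t₀ : ℝ} (hd : 0 < d) (h₀ : s₀ ≤ t₀)
    (hlip : ∀ s ∈ Icc s₀ t₀, ∀ t ∈ Icc s₀ t₀, s ≤ t → dist (x s) (x t) ≤ d * (t - s))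
    (hloc : ∀ τ ∈ Icc s₀ t₀, ∃ η > 0, ∀ s ∈ Icc s₀ t₀, ∀ t ∈ Icc s₀ t₀,
      |s - τ| < η → |t - τ| < η → s ≤ t → dist (x s) (x t) = d * (t - s)) :
    dist (x s₀) (x t₀) = d * (t₀ - s₀) := by
  have m₀ : s₀ ∈ Icc s₀ t₀ := ⟨le_rfl, h₀⟩
  have hcont : ContinuousOn x (Icc s₀ t₀) := by
    have : LipschitzOnWith d.toNNReal x (Icc s₀ t₀) := by
      refine LipschitzOnWith.of_dist_le_mul fun s hs t ht => ?_
      rw [Real.coe_toNNReal _ hd.le]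
      rcases le_total s t with h | h
      · rw [dist_comm s t, Real.dist_eq, abs_of_nonneg (by linarith)]
        exact hlip s hs t ht h
      · rw [Real.dist_eq, abs_of_nonneg (by linarith), dist_comm]
        exact hlip t ht s hs h
    exact this.continuousOn
  set S : Set ℝ := {t | dist (x s₀) (x t) = d * (t - s₀)} with hS
  have hclosed : IsClosed (S ∩ Icc s₀ t₀) := by
    have : IsClosed {t ∈ Icc s₀ t₀ | dist (x s₀) (x t) = d * (t - s₀)} :=
      isClosed_Icc.isClosed_eq (by fun_prop) (by fun_prop)
    rwa [inter_comm]
  have hsub : Icc s₀ t₀ ⊆ S := by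
    refine hclosed.Icc_subset_of_forall_mem_nhdsWithin (by simp [hS]) ?_
    rintro t ⟨htS, ht⟩
    have mt : t ∈ Icc s₀ t₀ := Ico_subset_Icc_self ht
    obtain ⟨η, hη, hl⟩ := hloc t mt
    have hpos : 0 < min η (t₀ - t) := lt_min hη (by linarith [ht.2])
    filter_upwards [Ioo_mem_nhdsGT (show t < t + min η (t₀ - t) by linarith)] with u hu
    have hu1 : u < t + η := hu.2.trans_le (by gcongr; exact min_le_left _ _)
    have hu2 : u < t + (t₀ - t) := hu.2.trans_le (by gcongr; exact min_le_right _ _)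
    have mu : u ∈ Icc s₀ t₀ := ⟨ht.1.trans hu.1.le, by linarith⟩
    have hut : |u - t| < η := by rw [abs_of_pos (by linarith [hu.1])]; linarith
    have htt : |t - t| < η := by simpa using hη
    rcases ht.1.eq_or_lt with rfl | hlt
    · exact hl s₀ mt u mu htt hut hu.1.le
    set r := max s₀ (t - η / 2) with hr
    have hrt : r < t := max_lt hlt (by linarith)
    have hr0 : s₀ ≤ r := le_max_left _ _
    have mr : r ∈ Icc s₀ t₀ := ⟨hr0, hrt.le.trans mt.2⟩
    have hrη : |r - t| < η := by
      rw [abs_of_neg (by linarith)]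
      linarith [le_max_right s₀ (t - η / 2)]
    have d1 := hl r mr t mt hrη htt hrt.le
    have d2 := hl t mt u mu htt hut hu.1.le
    have d3 := hl r mr u mu hrη hut (hrt.le.trans hu.1.le)
    have w1 : Wbtw ℝ (x r) (x t) (x u) := dist_add_dist_eq_iff.1 (by rw [d1, d2, d3]; ring)
    have d4 : dist (x s₀) (x t) = d * (t - s₀) := htS
    have d5 : dist (x s₀) (x r) = d * (r - s₀) := by
      refine le_antisymm (hlip _ m₀ _ mr hr0) ?_
      have := dist_triangle (x s₀) (x r) (x t)
      linarith
    have w2 : Wbtw ℝ (x s₀) (x r) (x t) := dist_add_dist_eq_iff.1 (by rw [d4, d5, d1]; ring)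
    have hne : x r ≠ x t := by
      rw [← dist_pos, d1]
      exact mul_pos hd (by linarith)
    have w3 := dist_add_dist_eq_iff.2 (w2.trans_expand_left w1 hne)
    change dist (x s₀) (x u) = d * (u - s₀)
    rw [← w3, d5, d3]
    ring
  exact hsub ⟨h₀, le_rfl⟩

/-- A shortest path in the closure of `V` realising the relative distance of two points. -/
theorem exists_geodesic {P Q : 𝔼} {d : ℝ} (hd : 0 ≤ d) (h : relDist V P Q = ENNReal.ofReal d) :
    ∃ x : ℝ → 𝔼, x 0 = P ∧ x 1 = Q ∧ (∀ s ∈ Icc (0 : ℝ) 1, x s ∈ closure V) ∧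
      (∀ s t, 0 ≤ s → s ≤ t → t ≤ 1 → relDist V (x s) (x t) ≤ ENNReal.ofReal (d * (t - s))) ∧
      ∀ s t, 0 ≤ s → s ≤ t → t ≤ 1 → ∀ c r, ball c r ⊆ V → x s ∈ ball c r → x t ∈ ball c r →
        d * (t - s) ≤ dist (x s) (x t) := by
  have hpos : ∀ k : ℕ, (0 : ℝ) < 1 / (k + 1) := fun k => by positivity
  have hex : ∀ k : ℕ, ∃ x : ℝ → 𝔼, dist (x 0) P < 1 / (k + 1) ∧ dist (x 1) Q < 1 / (k + 1) ∧
      (∀ s ∈ Icc (0 : ℝ) 1, x s ∈ V) ∧ ∀ s t, 0 ≤ s → s ≤ t → t ≤ 1 →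
        smoothPathInf V (x s) (x t) ≤ ENNReal.ofReal ((d + 1 / (k + 1)) * (t - s)) := by
    intro k
    have hlt : relDist V P Q < ENNReal.ofReal (d + 1 / (k + 1)) := by
      rw [h]
      exact (ENNReal.ofReal_lt_ofReal_iff (by have := hpos k; linarith)).2
        (by have := hpos k; linarith)
    have hfreq := frequently_lt_of_liminf_lt (by isBoundedDefault) hlt
    have hev : ∀ᶠ p : 𝔼 × 𝔼 in 𝓝[V] P ×ˢ 𝓝[V] Q,
        dist p.1 P < 1 / (k + 1) ∧ dist p.2 Q < 1 / (k + 1) :=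
      Filter.Eventually.prod_mk (nhdsWithin_le_nhds (ball_mem_nhds P (hpos k)))
        (nhdsWithin_le_nhds (ball_mem_nhds Q (hpos k)))
    obtain ⟨p, hp, hp1, hp2⟩ := (hfreq.and_eventually hev).exists
    obtain ⟨x, hx0, hx1, hx2, hx3⟩ := exists_lipschitz_param hp
    exact ⟨x, by rwa [hx0], by rwa [hx1], hx2, hx3⟩
  choose X hX0 hX1 hXV hXd using hex
  set 𝒰 : Ultrafilter ℕ := hyperfilter ℕ
  have h𝒰 : (𝒰 : Filter ℕ) ≤ atTop := Nat.hyperfilter_le_atTop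
  have hinv : Tendsto (fun k : ℕ => (1 : ℝ) / (k + 1)) 𝒰 (𝓝 0) :=
    tendsto_one_div_add_atTop_nhds_zero_nat.mono_left h𝒰
  have hXdist : ∀ k s t, 0 ≤ s → s ≤ t → t ≤ 1 →
      dist (X k s) (X k t) ≤ (d + 1 / (k + 1)) * (t - s) := fun k s t h0 hst h1 => by
    have := (edist_le_smoothPathInf V (X k s) (X k t)).trans (hXd k s t h0 hst h1)
    rw [edist_dist] at this
    exact (ENNReal.ofReal_le_ofReal_iff
      (mul_nonneg (by have := hpos k; linarith) (by linarith))).1 this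
  have hlim : ∀ s ∈ Icc (0 : ℝ) 1, ∃ y, Tendsto (fun k => X k s) 𝒰 (𝓝 y) := by
    intro s hs
    have hmem : ∀ k, X k s ∈ closedBall P (d + 2) := fun k => by
      have h1 := hXdist k 0 s le_rfl hs.1 hs.2
      have h2 := hX0 k
      have h3 : (1 : ℝ) / (k + 1) ≤ 1 := by
        rw [div_le_one (by positivity)]; linarith [(Nat.cast_nonneg k : (0 : ℝ) ≤ k)]
      have h4 := dist_triangle (X k s) (X k 0) P
      rw [dist_comm (X k s) (X k 0)] at h4
      have h5 : (d + 1 / (k + 1)) * (s - 0) ≤ (d + 1 / (k + 1)) * 1 :=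
        mul_le_mul_of_nonneg_left (by linarith [hs.2]) (by have := hpos k; linarith)
      rw [mem_closedBall]
      linarith
    obtain ⟨y, -, hy⟩ := (isCompact_closedBall P (d + 2)).ultrafilter_le_nhds'
      (𝒰.map fun k => X k s) (Ultrafilter.mem_map.2 (univ_mem' hmem))
    exact ⟨y, hy⟩
  choose! x hx using hlim
  have m0 : (0 : ℝ) ∈ Icc (0 : ℝ) 1 := by simp
  have m1 : (1 : ℝ) ∈ Icc (0 : ℝ) 1 := by simp
  have hP : Tendsto (fun k => X k 0) 𝒰 (𝓝 P) := tendsto_iff_dist_tendsto_zero.2 <|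
    squeeze_zero (fun _ => dist_nonneg) (fun k => (hX0 k).le) hinv
  have hQ : Tendsto (fun k => X k 1) 𝒰 (𝓝 Q) := tendsto_iff_dist_tendsto_zero.2 <|
    squeeze_zero (fun _ => dist_nonneg) (fun k => (hX1 k).le) hinv
  have hL : ∀ s t : ℝ, Tendsto (fun k : ℕ => ENNReal.ofReal ((d + 1 / (k + 1)) * (t - s))) 𝒰
      (𝓝 (ENNReal.ofReal (d * (t - s)))) := fun s t =>
    ENNReal.tendsto_ofReal (by simpa using (hinv.const_add d).mul_const (t - s))
  refine ⟨x, tendsto_nhds_unique (hx 0 m0) hP, tendsto_nhds_unique (hx 1 m1) hQ,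
    fun s hs => mem_closure_of_tendsto (hx s hs) (Eventually.of_forall fun k => hXV k s hs),
    fun s t h0 hst h1 => ?_, fun s t h0 hst h1 c r hball hs ht => ?_⟩
  · have ms : s ∈ Icc (0 : ℝ) 1 := ⟨h0, hst.trans h1⟩
    have mt : t ∈ Icc (0 : ℝ) 1 := ⟨h0.trans hst, h1⟩
    exact relDist_le_of_tendsto (hx s ms) (hx t mt) (Eventually.of_forall fun k => hXV k s ms)
      (Eventually.of_forall fun k => hXV k t mt)
      (Eventually.of_forall fun k => hXd k s t h0 hst h1) (hL s t)
  · have ms : s ∈ Icc (0 : ℝ) 1 := ⟨h0, hst.trans h1⟩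
    have mt : t ∈ Icc (0 : ℝ) 1 := ⟨h0.trans hst, h1⟩
    have hle : relDist V P Q ≤ ENNReal.ofReal (d * (s - 0)) + edist (x s) (x t) +
        ENNReal.ofReal (d * (1 - t)) := by
      refine relDist_le_of_tendsto hP hQ (Eventually.of_forall fun k => hXV k 0 m0)
        (Eventually.of_forall fun k => hXV k 1 m1) ?_
        (((hL 0 s).add ((hx s ms).edist (hx t mt))).add (hL t 1))
      filter_upwards [hx s ms (isOpen_ball.mem_nhds hs), hx t mt (isOpen_ball.mem_nhds ht)]
        with k hks hkt
      refine (smoothPathInf_triangle V _ (X k t) _).trans (add_le_add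
        ((smoothPathInf_triangle V _ (X k s) _).trans (add_le_add (hXd k 0 s le_rfl h0 ms.2) ?_))
        (hXd k t 1 mt.1 h1 le_rfl))
      exact smoothPathInf_le_edist (((convex_ball c r).segment_subset hks hkt).trans hball)
    rw [h, edist_dist, ← ENNReal.ofReal_add (mul_nonneg hd (by linarith)) dist_nonneg,
      ← ENNReal.ofReal_add (add_nonneg (mul_nonneg hd (by linarith)) dist_nonneg)
        (mul_nonneg hd (by linarith)), ENNReal.ofReal_le_ofReal_iff (add_nonneg (add_nonneg
          (mul_nonneg hd (by linarith)) dist_nonneg) (mul_nonneg hd (by linarith)))] at hle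
    linarith

/-- If a shortest path cannot touch the boundary in between, it is a segment. -/
theorem dist_eq_and_midpoint_mem (hV : IsOpen V) {P Q : 𝔼} {d : ℝ} (hd : 0 < d)
    (h : relDist V P Q = ENNReal.ofReal d)
    (hfr : ∀ z ∈ frontier V, ∀ τ ∈ Ioo (0 : ℝ) 1, relDist V P z ≤ ENNReal.ofReal (d * τ) →
      ¬ relDist V z Q ≤ ENNReal.ofReal (d * (1 - τ))) :
    dist P Q = d ∧ midpoint ℝ P Q ∈ V := by
  obtain ⟨x, rfl, rfl, hcl, hrel, hball⟩ := exists_geodesic hd.le h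
  have hlip : ∀ s t, 0 ≤ s → s ≤ t → t ≤ 1 → dist (x s) (x t) ≤ d * (t - s) :=
    fun s t h0 hst h1 => by
      have := edist_le_relDist.trans (hrel s t h0 hst h1)
      rw [edist_dist] at this
      exact (ENNReal.ofReal_le_ofReal_iff (mul_nonneg hd.le (by linarith))).1 this
  have hxV : ∀ τ ∈ Ioo (0 : ℝ) 1, x τ ∈ V := fun τ hτ => by
    by_contra hn
    refine hfr (x τ) ⟨hcl τ ⟨hτ.1.le, hτ.2.le⟩, by rwa [hV.interior_eq]⟩ τ hτ ?_
      (hrel τ 1 hτ.1.le hτ.2.le le_rfl)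
    simpa using hrel 0 τ le_rfl hτ.1.le hτ.2.le
  have hinner : ∀ s t, 0 < s → s ≤ t → t < 1 → dist (x s) (x t) = d * (t - s) := by
    intro s₀ t₀ h0 hst h1
    refine dist_eq_of_locally_dist_eq hd hst
      (fun s hs t ht hle => hlip s t (h0.le.trans hs.1) hle (ht.2.trans h1.le)) fun τ hτ => ?_
    obtain ⟨r, hr, hrV⟩ := Metric.isOpen_iff.1 hV (x τ)
      (hxV τ ⟨h0.trans_le hτ.1, hτ.2.trans_lt h1⟩)
    have hin : ∀ s ∈ Icc s₀ t₀, |s - τ| < r / d → x s ∈ ball (x τ) r := by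
      intro s hs hsτ
      rw [lt_div_iff₀ hd, mul_comm] at hsτ
      rw [mem_ball]
      refine lt_of_le_of_lt ?_ hsτ
      rcases le_total s τ with hle | hle
      · rw [abs_of_nonpos (by linarith)]
        simpa using hlip s τ (h0.le.trans hs.1) hle (hτ.2.trans h1.le)
      · rw [abs_of_nonneg (by linarith), dist_comm]
        exact hlip τ s (h0.le.trans hτ.1) hle (hs.2.trans h1.le)
    refine ⟨r / d, by positivity, fun s hs t ht hsτ htτ hle => le_antisymm
      (hlip s t (h0.le.trans hs.1) hle (ht.2.trans h1.le)) ?_⟩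
    exact hball s t (h0.le.trans hs.1) hle (ht.2.trans h1.le) _ _ hrV (hin s hs hsτ) (hin t ht htτ)
  have hdist : dist (x 0) (x 1) = d := by
    refine le_antisymm (by simpa using hlip 0 1 le_rfl zero_le_one le_rfl) ?_
    by_contra! hlt
    set ε := (d - dist (x 0) (x 1)) / (8 * d) with hε
    have hε0 : 0 < ε := div_pos (by linarith) (by linarith)
    have hε1 : ε ≤ 1 / 8 := by
      rw [hε, div_le_iff₀ (by linarith)]
      linarith [dist_nonneg (x := x 0) (y := x 1)]
    have hεd : d * ε * 8 = d - dist (x 0) (x 1) := by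
      rw [hε]; field_simp
    have h1 := hinner ε (1 - ε) hε0 (by linarith) (by linarith)
    have h2 := hlip 0 ε le_rfl hε0.le (by linarith)
    have h3 := hlip (1 - ε) 1 (by linarith) (by linarith) le_rfl
    have h4 := dist_triangle4 (x ε) (x 0) (x 1) (x (1 - ε))
    rw [dist_comm (x ε) (x 0), dist_comm (x 1)] at h4
    linarith
  refine ⟨hdist, ?_⟩
  have h1 := hlip 0 (1 / 2) le_rfl (by norm_num) (by norm_num)
  have h2 := hlip (1 / 2) 1 (by norm_num) (by norm_num) le_rfl
  have h3 := dist_triangle (x 0) (x (1 / 2)) (x 1)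
  rw [← eq_midpoint_of_dist_eq_half (x := x 0) (y := x (1 / 2)) (z := x 1) (by linarith)
    (by linarith)]
  exact hxV _ (by norm_num)

end Geodesics

section Boundary

local notation "𝔼" => EuclideanSpace ℝ (Fin 2)

theorem exists_coordinates {w : 𝔼} (hw : w ≠ 0) :
    ∃ (e : 𝔼) (π τ : 𝔼 →L[ℝ] ℝ), π e = 1 ∧ π w = 0 ∧ ∀ x, x = π x • e + τ x • w := by
  have hN : 0 < w 0 ^ 2 + w 1 ^ 2 := by
    by_contra! h
    refine hw ?_
    ext i
    fin_cases i
    · change w 0 = 0; nlinarith [sq_nonneg (w 0), sq_nonneg (w 1)]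
    · change w 1 = 0; nlinarith [sq_nonneg (w 0), sq_nonneg (w 1)]
  refine ⟨!₂[-w 1, w 0], (w 0 ^ 2 + w 1 ^ 2)⁻¹ •
    (w 0 • EuclideanSpace.proj 1 - w 1 • EuclideanSpace.proj 0), (w 0 ^ 2 + w 1 ^ 2)⁻¹ •
    (w 0 • EuclideanSpace.proj 0 + w 1 • EuclideanSpace.proj 1), ?_, ?_, fun x => ?_⟩
  · simp
    field_simp
  · simp
    right; ring
  · ext i
    fin_cases i <;> simp <;> field_simp <;> ring

/-- The boundary of an unbounded strictly convex plane domain is a graph over an open interval. -/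
theorem exists_frontier_param {U : Set 𝔼} (hU : IsOpen U) (hunbd : ¬ Bornology.IsBounded U)
    (hconv : IsStrictlyConvexDomain U) (hne : (frontier U).Nonempty) :
    ∃ (I : Set ℝ) (g : ℝ → 𝔼), IsOpen I ∧ IsPreconnected I ∧ ContinuousOn g I ∧ InjOn g I ∧
      g '' I = frontier U := by
  obtain ⟨hc, hstrict⟩ := hconv
  obtain ⟨w, hw0, hw⟩ : ∃ w ≠ 0, w ∈ asymptoticCone ℝ (closure U) := by
    rw [asymptoticCone_closure]
    exact not_bounded_iff_exists_ne_zero_mem_asymptoticCone.1 hunbd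
  have hray : ∀ v ∈ asymptoticCone ℝ (closure U), ∀ x ∈ closure U, ∀ t : ℝ, 0 ≤ t →
      x + t • v ∈ closure U := fun v hv x hx t ht => by
    have := hc.closure.smul_vadd_mem_of_isClosed_of_mem_asymptoticCone isClosed_closure ht hv hx
    rwa [vadd_eq_add, add_comm] at this
  have hup : ∀ x ∈ closure U, ∀ t : ℝ, 0 < t → x + t • w ∈ U := fun x hx t ht => by
    refine hstrict x hx (x + (2 * t) • w) (hray w hw x hx _ (by positivity)) ?_ ?_
    · simp [hw0, ht.ne']
    · exact ⟨1 / 2, 1 / 2, by norm_num, by norm_num, by norm_num, by module⟩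
  have hdown : -w ∉ asymptoticCone ℝ (closure U) := fun h => by
    obtain ⟨x, hx⟩ := hne
    rw [hU.frontier_eq] at hx
    refine hx.2 ?_
    have := hup _ (hray _ h x hx.1 1 zero_le_one) 1 one_pos
    simpa using this
  obtain ⟨e, π, τ, hπe, hπw, hcoord⟩ := exists_coordinates hw0
  set T : ℝ → Set ℝ := fun s => {t | s • e + t • w ∈ closure U} with hT
  have hTc : ∀ s, IsClosed (T s) := fun s => isClosed_closure.preimage (by fun_prop)
  have hTn : ∀ s ∈ π '' U, (T s).Nonempty := by
    rintro _ ⟨x, hx, rfl⟩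
    exact ⟨τ x, by simpa only [hT, mem_ofPred_eq, ← hcoord x] using subset_closure hx⟩
  have hTb : ∀ s, BddBelow (T s) := fun s => by
    by_contra hb
    rw [not_bddBelow_iff] at hb
    have hall : ∀ t, s • e + t • w ∈ closure U := fun t => by
      obtain ⟨t', ht', hlt⟩ := hb t
      have := hray w hw _ ht' (t - t') (by linarith)
      convert this using 1
      module
    refine hdown ?_
    rw [mem_asymptoticCone_iff]
    have h1 : Tendsto (fun t : ℝ => t • (-w) +ᵥ (s • e)) atTop
        (AffineSpace.asymptoticNhds ℝ 𝔼 (-w)) :=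
      (tendsto_id.atTop_smul_const_tendsto_asymptoticNhds (-w)).asymptoticNhds_vadd_const (s • e)
    refine h1.frequently (Frequently.of_forall fun t => ?_)
    have := hall (-t)
    rw [vadd_eq_add]
    convert this using 1
    module
  have hmem : ∀ s ∈ π '' U, s • e + sInf (T s) • w ∈ closure U := fun s hs =>
    (hTc s).csInf_mem (hTn s hs) (hTb s)
  have hI : ∀ x ∈ closure U, π x ∈ π '' U := fun x hx =>
    ⟨x + (1 : ℝ) • w, hup x hx 1 one_pos, by simp [hπw]⟩
  have hπsurj : Function.Surjective π := fun r => ⟨r • e, by simp [hπe]⟩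
  have hIo : IsOpen (π '' U) := π.isOpenMap hπsurj U hU
  have hIc : Convex ℝ (π '' U) := hc.linear_image (π : 𝔼 →ₗ[ℝ] ℝ)
  have hconvex : ConvexOn ℝ (π '' U) fun s => sInf (T s) := by
    refine ⟨hIc, fun s hs t ht a b ha hb hab => csInf_le (hTb _) ?_⟩
    have := hc.closure (hmem s hs) (hmem t ht) ha hb hab
    simp only [hT, mem_ofPred_eq]
    convert this using 1
    simp only [smul_eq_mul]
    module
  have hcont : ContinuousOn (fun s => sInf (T s)) (π '' U) := hconvex.continuousOn hIo
  refine ⟨π '' U, fun s => s • e + sInf (T s) • w, hIo, hIc.isPreconnected, by fun_prop,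
    fun s _ t _ hst => by simpa [hπe, hπw] using congrArg π hst, Subset.antisymm ?_ ?_⟩
  · rintro _ ⟨s, hs, rfl⟩
    rw [hU.frontier_eq]
    refine ⟨hmem s hs, fun hmU => ?_⟩
    have hpre : (fun t : ℝ => s • e + t • w) ⁻¹' U ∈ 𝓝 (sInf (T s)) :=
      (hU.preimage (by fun_prop)).mem_nhds hmU
    obtain ⟨t, hlt, ht⟩ := Filter.Eventually.exists_lt (p := fun t : ℝ => s • e + t • w ∈ U) hpre
    exact (csInf_le (hTb s) (subset_closure ht)).not_gt hlt
  · intro x hx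
    rw [hU.frontier_eq] at hx
    refine ⟨π x, hI x hx.1, ?_⟩
    have hτ : τ x ∈ T (π x) := by
      simpa only [hT, mem_ofPred_eq, ← hcoord x] using hx.1
    rcases (csInf_le (hTb _) hτ).eq_or_lt with h | h
    · change π x • e + sInf (T (π x)) • w = x
      rw [h, ← hcoord x]
    · refine absurd ?_ hx.2
      have := hup _ (hmem _ (hI x hx.1)) (τ x - sInf (T (π x))) (by linarith)
      convert this using 1
      conv_lhs => rw [hcoord x]
      module

end Boundary

section Extension

variable {E : Type*} [NormedAddCommGroup E] [InnerProductSpace ℝ E] [FiniteDimensional ℝ E]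

/-- A distance preserving map on an affinely spanning set extends to an isometry. -/
theorem exists_affineIsometryEquiv_eqOn {S : Set E} {F : E → E} (hS : affineSpan ℝ S = ⊤)
    (hF : ∀ a ∈ S, ∀ b ∈ S, dist (F a) (F b) = dist a b) :
    ∃ J : E ≃ᵃⁱ[ℝ] E, EqOn J F S := by
  have hne : S.Nonempty := by
    rw [← affineSpan_nonempty (k := ℝ), hS]
    exact ⟨0, trivial⟩
  obtain ⟨y, hy⟩ := hne
  have hspan : ⊤ ≤ Submodule.span ℝ ((· - y) '' S) := by
    have := vectorSpan_eq_span_vsub_set_right ℝ hy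
    rw [AffineSubspace.vectorSpan_eq_top_of_affineSpan_eq_top ℝ E E hS] at this
    exact this.le
  have hin : ∀ a ∈ S, ∀ b ∈ S, inner ℝ (F a - F y) (F b - F y) = inner ℝ (a - y) (b - y) := by
    intro a ha b hb
    simp only [real_inner_eq_norm_mul_self_add_norm_mul_self_sub_norm_sub_mul_self_div_two,
      sub_sub_sub_cancel_right, ← dist_eq_norm, hF a ha y hy, hF b hb y hy, hF a ha b hb]
  set B := Module.Basis.ofSpan hspan
  have hB : ∀ i, ∃ p ∈ S, p - y = B i := fun i => Module.Basis.ofSpan_subset hspan ⟨i, rfl⟩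
  choose p hpS hpB using hB
  set L : E →ₗ[ℝ] E := B.constr ℝ fun i => F (p i) - F y
  have hL : ∀ i, L (B i) = F (p i) - F y := fun i => B.constr_basis ℝ _ i
  have hLin : ∀ x z, inner ℝ (L x) (L z) = inner ℝ x z := by
    have : (innerₗ E).compl₁₂ L L = innerₗ E := by
      refine LinearMap.ext_basis B B fun i j => ?_
      simp only [LinearMap.compl₁₂_apply, innerₗ_apply_apply, hL, hin _ (hpS i) _ (hpS j), hpB]
    intro x z
    simpa using congrArg (fun f => f x z) this
  have hmix : ∀ a ∈ S, ∀ z, inner ℝ (F a - F y) (L z) = inner ℝ (a - y) z := by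
    intro a ha
    have : (innerₗ E (F a - F y)).comp L = innerₗ E (a - y) := by
      refine B.ext fun i => ?_
      simp only [LinearMap.comp_apply, innerₗ_apply_apply, hL, hin _ ha _ (hpS i), hpB]
    intro z
    exact congrArg (fun f => f z) this
  set Li : E ≃ₗᵢ[ℝ] E := (L.isometryOfInner hLin).toLinearIsometryEquiv rfl
  refine ⟨AffineIsometryEquiv.mk' (fun x => Li (x - y) + F y) Li y (by simp), fun a ha => ?_⟩
  have h0 : F a - F y - L (a - y) = 0 := by
    rw [← inner_self_eq_zero (𝕜 := ℝ)]
    rw [inner_sub_left (F a - F y), inner_sub_right (F a - F y), inner_sub_right (L (a - y)),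
      hmix a ha, hLin, hin a ha a ha, real_inner_comm (F a - F y), hmix a ha]
    ring
  change L (a - y) + F y = F a
  rw [← sub_eq_zero.1 h0, sub_add_cancel]

end Extension

section Frontier

local notation "𝔼" => EuclideanSpace ℝ (Fin 2)

theorem IsStrictlyConvexDomain.not_wbtw {n : ℕ} {U : Set (EuclideanSpace ℝ (Fin n))}
    (hU : IsOpen U) (hconv : IsStrictlyConvexDomain U) {a b c : EuclideanSpace ℝ (Fin n)}
    (ha : a ∈ frontier U) (hb : b ∈ frontier U) (hc : c ∈ frontier U) (hab : b ≠ a)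
    (hbc : b ≠ c) : ¬ Wbtw ℝ a b c := by
  intro h
  rw [hU.frontier_eq] at hb
  have hs : b ∈ openSegment ℝ a c :=
    mem_openSegment_of_ne_left_right hab.symm hbc.symm h.mem_segment
  refine hb.2 (hconv.2 a (frontier_subset_closure ha) c (frontier_subset_closure hc) ?_ hs)
  rintro rfl
  exact hab (by simpa using h)

theorem IsStrictlyConvexDomain.affineSpan_eq_top {U : Set 𝔼}
    (hU : IsOpen U) (hconv : IsStrictlyConvexDomain U) {S : Set 𝔼} (hS : S ⊆ frontier U)
    {a b c : 𝔼} (ha : a ∈ S) (hb : b ∈ S) (hc : c ∈ S) (hab : a ≠ b) (hbc : b ≠ c)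
    (hca : c ≠ a) : affineSpan ℝ S = ⊤ := by
  have hnc : ¬ Collinear ℝ {a, b, c} := fun h => by
    rcases h.wbtw_or_wbtw_or_wbtw with h | h | h
    · exact hconv.not_wbtw hU (hS ha) (hS hb) (hS hc) hab.symm hbc h
    · exact hconv.not_wbtw hU (hS hb) (hS hc) (hS ha) hbc.symm hca h
    · exact hconv.not_wbtw hU (hS hc) (hS ha) (hS hb) hca.symm hab h
  have htop := (affineIndependent_iff_not_collinear_set.2 hnc)
    |>.affineSpan_eq_top_iff_card_eq_finrank_add_one.2 (by simp)
  refine top_unique (htop.ge.trans (affineSpan_mono ℝ ?_))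
  rintro _ ⟨i, rfl⟩
  fin_cases i <;> assumption

/-- An open connected set that meets another open set but not its frontier lies inside it. -/
theorem IsPreconnected.subset_of_disjoint_frontier {X : Type*} [TopologicalSpace X] {s t : Set X}
    (hs : IsPreconnected s) (ht : IsOpen t) (hst : (s ∩ t).Nonempty)
    (hd : Disjoint s (frontier t)) : s ⊆ t := by
  refine IsPreconnected.subset_left_of_subset_union ht isClosed_closure.isOpen_compl
    (disjoint_compl_right.mono_left subset_closure |>.mono_right (by rfl)) (fun x hx => ?_) hst hs
  by_cases hxt : x ∈ t
  · exact Or.inl hxt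
  · refine Or.inr fun hxc => hd.notMem_of_mem_left hx ?_
    rw [ht.frontier_eq]
    exact ⟨hxc, hxt⟩

end Frontier

section Curve

local notation "𝔼" => EuclideanSpace ℝ (Fin 2)

theorem exists_complementary_functional {ℓ : 𝔼 →L[ℝ] ℝ} (hℓ : ℓ ≠ 0) :
    ∃ m : 𝔼 →L[ℝ] ℝ, ∀ z, ℓ z = 0 → m z = 0 → z = 0 := by
  set p := ℓ (EuclideanSpace.single 0 1)
  set q := ℓ (EuclideanSpace.single 1 1)
  have hz : ∀ z : 𝔼, ℓ z = z 0 * p + z 1 * q := fun z => by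
    have : z = z 0 • EuclideanSpace.single 0 1 + z 1 • EuclideanSpace.single 1 1 := by
      ext i
      fin_cases i <;> simp
    conv_lhs => rw [this]
    simp [p, q]
  have hpq : 0 < p ^ 2 + q ^ 2 := by
    by_contra! h
    refine hℓ ?_
    ext z
    have hp : p = 0 := by nlinarith [sq_nonneg p, sq_nonneg q]
    have hq : q = 0 := by nlinarith [sq_nonneg p, sq_nonneg q]
    simp [hz, hp, hq]
  refine ⟨p • EuclideanSpace.proj 1 - q • EuclideanSpace.proj 0, fun z h1 h2 => ?_⟩
  rw [hz] at h1
  replace h2 : p * z 1 - q * z 0 = 0 := by simpa using h2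
  have e0 : (p ^ 2 + q ^ 2) * z 0 = 0 := by linear_combination p * h1 - q * h2
  have e1 : (p ^ 2 + q ^ 2) * z 1 = 0 := by linear_combination q * h1 + p * h2
  ext i
  fin_cases i
  · exact (mul_eq_zero.1 e0).resolve_left hpq.ne'
  · exact (mul_eq_zero.1 e1).resolve_left hpq.ne'

theorem image_mem_nhds_of_injOn {k : ℝ → ℝ} {a b s : ℝ} (hs : s ∈ Ioo a b)
    (hk : ContinuousOn k (Icc a b)) (hi : InjOn k (Icc a b)) : k '' Icc a b ∈ 𝓝 (k s) := by
  have hab : a ≤ b := (hs.1.trans hs.2).le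
  have hsI : s ∈ Icc a b := Ioo_subset_Icc_self hs
  rcases hk.strictMonoOn_of_injOn_Icc' hab hi with h | h
  · exact mem_of_superset (Icc_mem_nhds (h (left_mem_Icc.2 hab) hsI hs.1)
      (h hsI (right_mem_Icc.2 hab) hs.2)) (intermediate_value_Icc hab hk)
  · exact mem_of_superset (Icc_mem_nhds (h hsI (right_mem_Icc.2 hab) hs.2)
      (h (left_mem_Icc.2 hab) hsI hs.1)) (intermediate_value_Icc' hab hk)

/-- A continuous injective curve in a `C¹` plane boundary is locally onto. -/
theorem HasC1Boundary.image_mem_nhdsWithin {V : Set 𝔼} (hV : HasC1Boundary V) {h : ℝ → 𝔼}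
    {N : Set ℝ} {s : ℝ} (hN : N ∈ 𝓝 s) (hc : ContinuousOn h N) (hi : InjOn h N)
    (hm : MapsTo h N (frontier V)) : h '' N ∈ 𝓝[frontier V] (h s) := by
  obtain ⟨W, W', φ, ψ, ℓ, hWo, hsW, -, hℓ, hφ, -, -, -, hψφ, -, him⟩ :=
    hV (h s) (hm (mem_of_mem_nhds hN))
  obtain ⟨m, hm0⟩ := exists_complementary_functional hℓ
  have hκi : InjOn (m ∘ φ) (W ∩ frontier V) := by
    intro z hz z' hz' heq
    have h1 : ℓ (φ z) = 0 := (him.le (mem_image_of_mem φ hz)).2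
    have h2 : ℓ (φ z') = 0 := (him.le (mem_image_of_mem φ hz')).2
    have := hm0 (φ z - φ z') (by rw [map_sub, h1, h2, sub_zero])
      (by rw [map_sub]; exact sub_eq_zero.2 heq)
    rw [← hψφ z hz.1, ← hψφ z' hz'.1, sub_eq_zero.1 this]
  have hκc : ContinuousOn (m ∘ φ) W := m.continuous.comp_continuousOn hφ.continuousOn
  have hNW : N ∩ h ⁻¹' W ∈ 𝓝 s :=
    inter_mem hN ((hc.continuousAt hN).preimage_mem_nhds (hWo.mem_nhds hsW))
  obtain ⟨η, hη, hball⟩ := nhds_basis_closedBall.mem_iff.1 hNW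
  rw [Real.closedBall_eq_Icc] at hball
  have hsub : MapsTo h (Icc (s - η) (s + η)) (W ∩ frontier V) := fun t ht =>
    ⟨(hball ht).2, hm (hball ht).1⟩
  have hn : (m ∘ φ) ∘ h '' Icc (s - η) (s + η) ∈ 𝓝 ((m ∘ φ) (h s)) :=
    image_mem_nhds_of_injOn (k := (m ∘ φ) ∘ h) ⟨by linarith, by linarith⟩
      (hκc.comp (hc.mono fun t ht => (hball ht).1) fun t ht => (hball ht).2)
      (hκi.comp (hi.mono fun t ht => (hball ht).1) hsub)
  filter_upwards [mem_nhdsWithin_of_mem_nhds ((hκc.continuousAt (hWo.mem_nhds hsW)) hn),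
    mem_nhdsWithin_of_mem_nhds (hWo.mem_nhds hsW), self_mem_nhdsWithin] with z hz hzW hzV
  obtain ⟨t, ht, hte⟩ := hz
  exact ⟨t, (hball ht).1, hκi (hsub ht) ⟨hzW, hzV⟩ hte⟩

end Curve

section Rigidity

variable {n : ℕ} {U V : Set (EuclideanSpace ℝ (Fin n))}
  {f : EuclideanSpace ℝ (Fin n) → EuclideanSpace ℝ (Fin n)}
  {g : ℝ → EuclideanSpace ℝ (Fin n)} {I : Set ℝ}

theorem IsBoundaryLocalIsometry.eventually_relDist_eq (hf : IsBoundaryLocalIsometry U V f)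
    (hconv : Convex ℝ U) (hI : IsOpen I) (hgc : ContinuousOn g I)
    (hgI : MapsTo g I (frontier U)) {s : ℝ} (hs : s ∈ I) :
    ∃ N ∈ 𝓝 s, N ⊆ I ∧ ∀ a ∈ N, ∀ b ∈ N,
      relDist V (f (g a)) (f (g b)) = edist (g a) (g b) := by
  have hrel : ∀ a ∈ I, ∀ b ∈ I, relDist U (g a) (g b) = edist (g a) (g b) := fun a ha b hb =>
    relDist_eq_edist_of_convex hconv (frontier_subset_closure (hgI ha))
      (frontier_subset_closure (hgI hb))
  obtain ⟨ε, hε, hε'⟩ := hf.2 (g s) (hgI hs)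
  refine ⟨I ∩ g ⁻¹' Metric.eball (g s) ε, inter_mem (hI.mem_nhds hs)
    ((hgc.continuousAt (hI.mem_nhds hs)).preimage_mem_nhds (Metric.eball_mem_nhds _ hε)),
    inter_subset_left, fun a ha b hb => ?_⟩
  rw [← hrel a ha.1 b hb.1]
  exact (hε' _ (hgI ha.1) _ (hgI hb.1) ((hrel a ha.1 s hs).trans_lt ha.2)
    ((hrel b hb.1 s hs).trans_lt hb.2)).symm

theorem IsBoundaryLocalIsometry.continuousOn_comp (hf : IsBoundaryLocalIsometry U V f)
    (hconv : Convex ℝ U) (hI : IsOpen I) (hgc : ContinuousOn g I)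
    (hgI : MapsTo g I (frontier U)) : ContinuousOn (f ∘ g) I := by
  intro s hs
  obtain ⟨N, hN, -, hrel⟩ := hf.eventually_relDist_eq hconv hI hgc hgI hs
  refine ContinuousAt.continuousWithinAt ?_
  rw [EMetric.continuousAt_iff]
  intro ε hε
  have hg := hgc.continuousAt (hI.mem_nhds hs)
  have := inter_mem hN (hg.preimage_mem_nhds (Metric.eball_mem_nhds _ hε))
  obtain ⟨δ, hδ, hball⟩ := EMetric.mem_nhds_iff.1 this
  refine ⟨δ, hδ, fun t ht => ?_⟩
  have ht' := hball (Metric.mem_eball.2 ht)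
  exact (edist_le_relDist.trans (hrel t ht'.1 s (mem_of_mem_nhds hN)).le).trans_lt ht'.2

end Rigidity

section PlaneRigidity

local notation "𝔼" => EuclideanSpace ℝ (Fin 2)

variable {U V : Set 𝔼} {f : 𝔼 → 𝔼} {g : ℝ → 𝔼} {I : Set ℝ}

/-- A local isometry of the boundary of a strictly convex plane domain in the relative metrics
locally preserves Euclidean distances. -/
theorem IsBoundaryLocalIsometry.eventually_dist_eq (hf : IsBoundaryLocalIsometry U V f)
    (hU : IsOpen U) (hconv : IsStrictlyConvexDomain U) (hV : IsOpen V) (hVb : HasC1Boundary V)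
    (hI : IsOpen I) (hgc : ContinuousOn g I) (hgi : InjOn g I)
    (hgI : MapsTo g I (frontier U)) {s : ℝ} (hs : s ∈ I) :
    ∃ N ∈ 𝓝 s, N ⊆ I ∧ ∀ a ∈ N, ∀ b ∈ N, a ≠ b →
      dist (f (g a)) (f (g b)) = dist (g a) (g b) ∧ midpoint ℝ (f (g a)) (f (g b)) ∈ V := by
  obtain ⟨N, hN, hNI, hrel⟩ := hf.eventually_relDist_eq hconv.1 hI hgc hgI hs
  have hsN := mem_of_mem_nhds hN
  have hle : ∀ a ∈ N, ∀ b ∈ N, dist (f (g a)) (f (g b)) ≤ dist (g a) (g b) :=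
    fun a ha b hb => by
      have := edist_le_relDist.trans (hrel a ha b hb).le
      rwa [edist_dist, edist_dist, ENNReal.ofReal_le_ofReal_iff dist_nonneg] at this
  have himg : (f ∘ g) '' N ∈ 𝓝[frontier V] (f (g s)) :=
    hVb.image_mem_nhdsWithin hN ((hf.continuousOn_comp hconv.1 hI hgc hgI).mono hNI)
      ((hf.1.injOn.comp hgi hgI).mono hNI) fun t ht => hf.1.mapsTo (hgI (hNI ht))
  obtain ⟨r, hr, hball⟩ := Metric.mem_nhdsWithin_iff.1 himg
  refine ⟨N ∩ g ⁻¹' ball (g s) (r / 3), inter_mem hN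
    ((hgc.continuousAt (hI.mem_nhds hs)).preimage_mem_nhds (ball_mem_nhds _ (by positivity))),
    inter_subset_left.trans hNI, ?_⟩
  rintro a ⟨haN, har⟩ b ⟨hbN, hbr⟩ hab
  have hd : 0 < dist (g a) (g b) := dist_pos.2 (hgi.ne (hNI haN) (hNI hbN) hab)
  have hd' : dist (g a) (g b) < 2 * r / 3 := by
    have := dist_triangle_right (g a) (g b) (g s)
    have h1 : dist (g a) (g s) < r / 3 := har
    have h2 : dist (g b) (g s) < r / 3 := hbr
    linarith
  refine dist_eq_and_midpoint_mem hV hd (by rw [hrel a haN b hbN, edist_dist]) ?_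
  intro z hz τ hτ h1 h2
  have hdτ : dist (g a) (g b) * τ < dist (g a) (g b) := by nlinarith [hτ.2]
  have hdτ' : dist (g a) (g b) * (1 - τ) < dist (g a) (g b) := by nlinarith [hτ.1]
  have hdτ0 : 0 ≤ dist (g a) (g b) * τ := mul_nonneg hd.le hτ.1.le
  have hdτ0' : 0 ≤ dist (g a) (g b) * (1 - τ) := mul_nonneg hd.le (by linarith [hτ.2])
  have hzr : dist z (f (g s)) < r := by
    have h3 := edist_le_relDist.trans h1
    rw [edist_dist, ENNReal.ofReal_le_ofReal_iff hdτ0] at h3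
    have h4 := hle a haN s hsN
    have h5 : dist (g a) (g s) < r / 3 := har
    have := dist_triangle_left z (f (g s)) (f (g a))
    linarith
  obtain ⟨c, hcN, rfl⟩ := hball ⟨hzr, hz⟩
  rw [Function.comp_apply, hrel _ haN _ hcN, edist_dist, ENNReal.ofReal_le_ofReal_iff hdτ0] at h1
  rw [Function.comp_apply, hrel _ hcN _ hbN, edist_dist, ENNReal.ofReal_le_ofReal_iff hdτ0'] at h2
  refine hconv.not_wbtw hU (hgI (hNI haN)) (hgI (hNI hcN)) (hgI (hNI hbN)) ?_ ?_
    (dist_add_dist_eq_iff.1 (le_antisymm (by linarith) (dist_triangle _ _ _)))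
  · intro h
    rw [h] at h2
    linarith
  · intro h
    rw [h] at h1
    linarith

theorem IsBoundaryLocalIsometry.exists_eqOn (hf : IsBoundaryLocalIsometry U V f)
    (hU : IsOpen U) (hconv : IsStrictlyConvexDomain U) (hV : IsOpen V) (hVb : HasC1Boundary V)
    (hI : IsOpen I) (hIc : IsPreconnected I) (hgc : ContinuousOn g I) (hgi : InjOn g I)
    (hgI : MapsTo g I (frontier U)) (hIn : I.Nonempty) :
    ∃ J : 𝔼 ≃ᵃⁱ[ℝ] 𝔼, ∀ t ∈ I, J (g t) = f (g t) := by
  have hspan : ∀ s : ℝ, ∀ N ∈ 𝓝 s, N ⊆ I → affineSpan ℝ (g '' N) = ⊤ := by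
    intro s N hN hNI
    obtain ⟨η, hη, hball⟩ := nhds_basis_closedBall.mem_iff.1 hN
    rw [Real.closedBall_eq_Icc] at hball
    have h1 : s - η ∈ N := hball ⟨le_rfl, by linarith⟩
    have h2 : s ∈ N := hball ⟨by linarith, by linarith⟩
    have h3 : s + η ∈ N := hball ⟨by linarith, le_rfl⟩
    exact hconv.affineSpan_eq_top hU (hgI.mono_left hNI).image_subset (mem_image_of_mem g h1)
      (mem_image_of_mem g h2) (mem_image_of_mem g h3)
      (hgi.ne (hNI h1) (hNI h2) (by linarith)) (hgi.ne (hNI h2) (hNI h3) (by linarith))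
      (hgi.ne (hNI h3) (hNI h1) (by linarith))
  have hloc : ∀ s : I, ∃ J : 𝔼 ≃ᵃⁱ[ℝ] 𝔼, ∃ N ∈ 𝓝 (s : ℝ), N ⊆ I ∧
      ∀ t ∈ N, J (g t) = f (g t) := by
    rintro ⟨s, hs⟩
    obtain ⟨N, hN, hNI, hd⟩ := hf.eventually_dist_eq hU hconv hV hVb hI hgc hgi hgI hs
    obtain ⟨J, hJ⟩ := exists_affineIsometryEquiv_eqOn (F := f) (hspan s N hN hNI) (by
      rintro _ ⟨a, ha, rfl⟩ _ ⟨b, hb, rfl⟩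
      rcases eq_or_ne a b with rfl | hab
      · simp
      · exact (hd a ha b hb hab).1)
    exact ⟨J, N, hN, hNI, fun t ht => hJ (mem_image_of_mem g ht)⟩
  choose J N hN hNI hJ using hloc
  have hlc : IsLocallyConstant J := by
    rw [IsLocallyConstant.iff_eventually_eq]
    intro s
    have hev : ∀ᶠ t : I in 𝓝 s, N s ∈ 𝓝 (t : ℝ) :=
      continuous_subtype_val.continuousAt.eventually (eventually_mem_nhds_iff.2 (hN s))
    filter_upwards [hev] with t ht
    have := AffineMap.ext_on (f := (J t).toAffineEquiv.toAffineMap)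
      (g := (J s).toAffineEquiv.toAffineMap)
      (hspan t (N t ∩ N s) (inter_mem (hN t) ht) (inter_subset_left.trans (hNI t)))
      (by
        rintro _ ⟨c, hc, rfl⟩
        exact (hJ t c hc.1).trans (hJ s c hc.2).symm)
    ext1 x
    exact congrArg (fun k : 𝔼 →ᵃ[ℝ] 𝔼 => k x) this
  have := isPreconnected_iff_preconnectedSpace.1 hIc
  obtain ⟨s, hs⟩ := hIn
  refine ⟨J ⟨s, hs⟩, fun t ht => ?_⟩
  rw [hlc.apply_eq_of_preconnectedSpace ⟨s, hs⟩ ⟨t, ht⟩]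
  exact hJ ⟨t, ht⟩ t (mem_of_mem_nhds (hN ⟨t, ht⟩))

end PlaneRigidity

/-- an unbounded strictly convex plane domain with smooth boundary
is uniquely determined, in the class of all plane domains with smooth
boundaries, by the condition of local isometry of boundaries in the relative
metrics. -/
theorem unbounded_strictly_convex_uniquely_determined
    (U : Set (EuclideanSpace ℝ (Fin 2)))
    (hU : IsDomainSet U) (hUunbd : ¬ Bornology.IsBounded U)
    (hUconv : IsStrictlyConvexDomain U) (hUb : HasC1Boundary U) :
    ∀ V : Set (EuclideanSpace ℝ (Fin 2)), IsDomainSet V → HasC1Boundary V →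
      (∃ f : EuclideanSpace ℝ (Fin 2) → EuclideanSpace ℝ (Fin 2),
        IsBoundaryLocalIsometry U V f) →
      ∃ J : EuclideanSpace ℝ (Fin 2) ≃ᵢ EuclideanSpace ℝ (Fin 2), J '' U = V := by
  rintro V ⟨hVo, hVc⟩ hVb ⟨f, hf⟩
  obtain ⟨hUo, hUc⟩ := hU
  rcases (frontier U).eq_empty_or_nonempty with h0 | hne
  · have hV0 : frontier V = ∅ := by rw [← hf.1.image_eq, h0, image_empty]
    have huniv : ∀ W : Set (EuclideanSpace ℝ (Fin 2)), W.Nonempty → frontier W = ∅ → W = univ :=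
      fun W hW hW0 => (isClopen_iff.1 (isClopen_iff_frontier_eq_empty.2 hW0)).resolve_left
        hW.ne_empty
    refine ⟨IsometryEquiv.refl _, ?_⟩
    rw [huniv U hUc.nonempty h0, huniv V hVc.nonempty hV0]
    simp
  obtain ⟨I, g, hI, hIc, hgc, hgi, hg⟩ := exists_frontier_param hUo hUunbd hUconv hne
  have hgI : MapsTo g I (frontier U) := fun t ht => hg.le (mem_image_of_mem g ht)
  have hIn : I.Nonempty := by
    rw [← hg] at hne
    exact hne.of_image
  obtain ⟨J, hJ⟩ := hf.exists_eqOn hUo hUconv hVo hVb hI hIc hgc hgi hgI hIn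
  have hfr : frontier (J '' U) = frontier V := by
    rw [← hf.1.image_eq, ← hg, ← image_comp]
    have := J.toHomeomorph.image_frontier U
    rw [← hg, ← image_comp] at this
    exact this.symm.trans (image_congr fun t ht => hJ t ht)
  have hJo : IsOpen (J '' U) := J.toHomeomorph.isOpenMap U hUo
  obtain ⟨s, hs⟩ := hIn
  obtain ⟨N, hN, hNI, hd⟩ := hf.eventually_dist_eq hUo hUconv hVo hVb hI hgc hgi hgI hs
  obtain ⟨η, hη, hball⟩ := nhds_basis_closedBall.mem_iff.1 hN
  rw [Real.closedBall_eq_Icc] at hball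
  have hsN : s ∈ N := mem_of_mem_nhds hN
  have htN : s + η ∈ N := hball ⟨by linarith, le_rfl⟩
  have hst : s ≠ s + η := by linarith
  have hmU : midpoint ℝ (g s) (g (s + η)) ∈ U :=
    hUconv.2 _ (frontier_subset_closure (hgI hs)) _ (frontier_subset_closure (hgI (hNI htN)))
      (hgi.ne hs (hNI htN) hst) ⟨1 / 2, 1 / 2, by norm_num, by norm_num, by norm_num, by
        rw [midpoint_eq_smul_add, invOf_eq_inv]; module⟩
  have hmV : J (midpoint ℝ (g s) (g (s + η))) ∈ V := by
    have hJm : J (midpoint ℝ (g s) (g (s + η))) = midpoint ℝ (J (g s)) (J (g (s + η))) :=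
      J.toAffineEquiv.map_midpoint _ _
    rw [hJm, hJ s hs, hJ _ (hNI htN)]
    exact (hd s hsN _ htN hst).2
  refine ⟨J.toIsometryEquiv, (?_ : J '' U = V)⟩
  refine Subset.antisymm ?_ ?_
  · refine (hUc.isPreconnected.image J J.continuous.continuousOn).subset_of_disjoint_frontier hVo
      ⟨_, mem_image_of_mem J hmU, hmV⟩ ?_
    rw [← hfr, disjoint_iff_inter_eq_empty, hJo.inter_frontier_eq]
  · refine hVc.isPreconnected.subset_of_disjoint_frontier hJo
      ⟨_, hmV, mem_image_of_mem J hmU⟩ ?_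
    rw [hfr, disjoint_iff_inter_eq_empty, hVo.inter_frontier_eq]

end
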